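/- Let T ⊂ ℝ² be a nondegenerate closed triangle and f : T → ℝ a bounded function that is Riemann integrable on T in the triangular-subdivision sense with integral mean μ. Then f is integrable with respect to (the completion of) two-dimensional Lebesgue measure on T and ∫_T f dλ = μ·vol(T). -/

import Mathlib

open MeasureTheory Filter Real

noncomputable section

/-- Points of the plane. -/
abbrev Pt := ℝ × ℝ

/-- The (closed) triangle with vertices `A`, `B`, `C`: their convex hull. -/
def triangle (A B C : Pt) : Set Pt := convexHull ℝ {A, B, C}

/-- The triangle `Δ(A,B,C)` is nondegenerate iff `A`, `B`, `C` are not collinear. -/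
def Nondeg (A B C : Pt) : Prop := ¬ Collinear ℝ ({A, B, C} : Set Pt)

/-- Two-dimensional Lebesgue volume, as a real number. -/
def vol (S : Set Pt) : ℝ := (volume S).toReal

/-- Signed discrepancy `δ_N(S; P, Ω)` of the list of points `P` at the set `S`,
relative to the domain `Ω`. -/
def sdisc {N : ℕ} (S : Set Pt) (P : Fin N → Pt) (Ω : Set Pt) : ℝ :=
  vol (S ∩ Ω) / vol Ω - (Nat.card {i : Fin N // P i ∈ S} : ℝ) / N

/-- Discrepancy `D_N(𝒮; P, Ω)`: supremum of the absolute signed discrepancy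
over a class `𝒮` of sets. -/
def Disc {N : ℕ} (𝒮 : Set (Set Pt)) (P : Fin N → Pt) (Ω : Set Pt) : ℝ :=
  ⨆ S ∈ 𝒮, |sdisc S P Ω|

/-- The half-open parallelogram `𝒯_{a,b,C}` anchored at `C` with sides
`a(A-C)` and `b(B-C)`. -/
def parlg (A B C : Pt) (a b : ℝ) : Set Pt :=
  {x | ∃ s t : ℝ, 0 ≤ s ∧ s < a ∧ 0 ≤ t ∧ t < b ∧ x = C + s • (A - C) + t • (B - C)}

/-- The family `𝒮_C` of parallelograms anchored at `C`, intersected with the triangle. -/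
def anchoredFam (A B C : Pt) : Set (Set Pt) :=
  {S | ∃ a b : ℝ, 0 < a ∧ a ≤ 1 ∧ 0 < b ∧ b ≤ 1 ∧ S = parlg A B C a b ∩ triangle A B C}

/-- The class `𝒮_A ∪ 𝒮_B ∪ 𝒮_C` of anchored parallelograms of the triangle `Δ(A,B,C)`. -/
def parFam (A B C : Pt) : Set (Set Pt) :=
  anchoredFam B C A ∪ anchoredFam A C B ∪ anchoredFam A B C

/-- The parallelogram discrepancy `D_N^P(P; Δ(A,B,C))`. -/
def parDisc {N : ℕ} (P : Fin N → Pt) (A B C : Pt) : ℝ :=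
  Disc (parFam A B C) P (triangle A B C)

/-- Midpoint of two points. -/
def mid (P Q : Pt) : Pt := (2⁻¹ : ℝ) • (P + Q)

/-- A triangle recorded as the (ordered) triple of its vertices. -/
abbrev Tri2 := Pt × Pt × Pt

/-- The centroid of a triangle: the average of its three vertices. -/
def ctr (T : Tri2) : Pt := (3⁻¹ : ℝ) • (T.1 + T.2.1 + T.2.2)

/-- The point set of a triangle given by its vertices. -/
def triSet (T : Tri2) : Set Pt := triangle T.1 T.2.1 T.2.2

/-- The four-way subdivision of a triangle: subtriangle number `d ∈ {0,1,2,3}`. -/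
def subdiv (T : Tri2) (d : ℕ) : Tri2 :=
  let A := T.1; let B := T.2.1; let C := T.2.2
  if d = 0 then (mid B C, mid A C, mid A B)
  else if d = 1 then (A, mid A B, mid A C)
  else if d = 2 then (mid A B, B, mid B C)
  else (mid A C, mid B C, C)

/-- The triangular van der Corput point `f_T(i)`: digits of `i` in base `4` select a
nested subtriangle, and `f_T(i)` is its centroid. -/
def vdc (T : Tri2) (i : ℕ) : Pt :=
  if h : i = 0 then ctr T else vdc (subdiv T (i % 4)) (i / 4)
termination_by i
decreasing_by exact Nat.div_lt_self (Nat.pos_of_ne_zero h) (by norm_num)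

/-- The `i`-th subtriangle (for `i < 4^k`) of the standard level-`k` subdivision of `T`,
indexed by the base-4 digits of `i`. -/
def subdivAt (T : Tri2) : ℕ → ℕ → Tri2
  | 0, _ => T
  | (k+1), i => subdiv (subdivAt T k (i / 4)) (i % 4)

/-- The standard level-`k` subdivision of a triangle: the set of the `4^k` congruent
subtriangles obtained by `k` recursive four-way subdivisions. -/
def level (T : Tri2) : ℕ → Set Tri2
  | 0 => {T}
  | (k+1) => {S | ∃ S' ∈ level T k, ∃ d < 4, S = subdiv S' d}

/-- Riemann integrability (in the triangular-subdivision sense) of `f` on the closed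
triangle `T`, with integral mean `μ`: every sequence of tagged Riemann sums over the
level-`k` subdivisions converges to `μ`. -/
def RiemannMean (T : Tri2) (f : Pt → ℝ) (μ : ℝ) : Prop :=
  ∀ x : ℕ → ℕ → Pt, (∀ k i, i < 4^k → x k i ∈ triSet (subdivAt T k i)) →
    Tendsto (fun k => (4^k : ℝ)⁻¹ * ∑ i ∈ Finset.range (4^k), f (x k i)) atTop (nhds μ)

/-- A real number is a quadratic irrational if it has the form `(a + b√c)/d` with
integers `a,b,c,d`, `b ≠ 0`, `d ≠ 0`, `c > 0` and `c` not a perfect square. -/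
def QuadIrr (θ : ℝ) : Prop :=
  ∃ a b c d : ℤ, b ≠ 0 ∧ d ≠ 0 ∧ 0 < c ∧ (∀ m : ℤ, c ≠ m ^ 2) ∧
    θ = ((a : ℝ) + (b : ℝ) * Real.sqrt (c : ℝ)) / (d : ℝ)

/-- Distance from a real number to the nearest integer. -/
def distToInt (x : ℝ) : ℝ := |x - round x|

/-- A real number `θ` is badly approximable if `n‖nθ‖ > c` for all positive `n`,
for some constant `c > 0`. -/
def BadlyApprox (θ : ℝ) : Prop :=
  ∃ c : ℝ, 0 < c ∧ ∀ n : ℕ, 0 < n → c < (n : ℝ) * distToInt ((n : ℝ) * θ)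

end

section Sandwich

variable {α : Type*} [MeasurableSpace α]

/-- A function squeezed between two sequences of integrable functions whose integrals have the
same limit is integrable, with that limit as its integral. -/
theorem integrable_and_integral_eq_of_squeeze {ν : Measure α} {f : α → ℝ} {l u : ℕ → α → ℝ}
    {c : ℝ} (hl : ∀ k, Integrable (l k) ν) (hu : ∀ k, Integrable (u k) ν)
    (hlf : ∀ k, l k ≤ᵐ[ν] f) (hfu : ∀ k, f ≤ᵐ[ν] u k)
    (hlc : Tendsto (fun k => ∫ x, l k x ∂ν) atTop (nhds c))
    (huc : Tendsto (fun k => ∫ x, u k x ∂ν) atTop (nhds c)) :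
    Integrable f ν ∧ ∫ x, f x ∂ν = c := by
  have hd : ∀ k, Integrable (fun x => u k x - l k x) ν := fun k => (hu k).sub (hl k)
  have hnorm : ∀ k, eLpNorm ((fun x => u k x - l k x) - (0 : α → ℝ)) 1 ν
      = ENNReal.ofReal (∫ x, u k x ∂ν - ∫ x, l k x ∂ν) := by
    intro k
    rw [sub_zero, eLpNorm_one_eq_lintegral_enorm, ← ofReal_integral_norm_eq_lintegral_enorm (hd k),
      ← integral_sub (hu k) (hl k)]
    congr 1
    refine integral_congr_ae ?_
    filter_upwards [hlf k, hfu k] with x h1 h2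
    exact Real.norm_of_nonneg (sub_nonneg.2 (h1.trans h2))
  have hmeas : TendstoInMeasure ν (fun k x => u k x - l k x) atTop (0 : α → ℝ) := by
    refine tendstoInMeasure_of_tendsto_eLpNorm one_ne_zero
      (fun k => (hd k).aestronglyMeasurable) aestronglyMeasurable_zero ?_
    simp_rw [hnorm]
    simpa using ENNReal.tendsto_ofReal (huc.sub hlc)
  obtain ⟨ns, -, hns⟩ := hmeas.exists_seq_tendsto_ae
  have hf : AEStronglyMeasurable f ν := by
    refine aestronglyMeasurable_of_tendsto_ae atTop
      (fun k => (hl (ns k)).aestronglyMeasurable) ?_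
    filter_upwards [hns, ae_all_iff.2 hlf, ae_all_iff.2 hfu] with x hx h1 h2
    have h3 : Tendsto (fun k => f x - (u (ns k) x - l (ns k) x)) atTop (nhds (f x)) := by
      simpa using tendsto_const_nhds.sub hx
    refine tendsto_of_tendsto_of_tendsto_of_le_of_le h3 tendsto_const_nhds (fun k => ?_)
      (fun k => h1 (ns k))
    have := h2 (ns k)
    dsimp only
    linarith
  have hfi : Integrable f ν := integrable_of_le_of_le hf (hlf 0) (hfu 0) (hl 0) (hu 0)
  exact ⟨hfi, le_antisymm (ge_of_tendsto' huc fun k => integral_mono_ae hfi (hu k) (hfu k))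
    (le_of_tendsto' hlc fun k => integral_mono_ae (hl k) hfi (hlf k))⟩

/-- If `n` measurable sets, each of measure at most `ν Ω / n`, cover `Ω`, then there is a step
function taking a prescribed value on each of them (up to overlaps), whose integral over `Ω` is
the corresponding Riemann sum. -/
theorem exists_step_function {ν : Measure α} {Ω : Set α} (hΩ : ν Ω ≠ ⊤) {n : ℕ} (hn : 0 < n)
    {S : ℕ → Set α} (hS : ∀ i, MeasurableSet (S i)) (hSΩ : ∀ i, S i ⊆ Ω)
    (hcov : ∀ x ∈ Ω, ∃ i < n, x ∈ S i) (hvol : ∀ i, ν.real (S i) ≤ (n : ℝ)⁻¹ * ν.real Ω)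
    (c : ℕ → ℝ) :
    ∃ g : α → ℝ, IntegrableOn g Ω ν ∧
      ∫ x in Ω, g x ∂ν = ν.real Ω * ((n : ℝ)⁻¹ * ∑ i ∈ Finset.range n, c i) ∧
      ∀ x ∈ Ω, ∃ i < n, x ∈ S i ∧ g x = c i := by
  set D := disjointed S
  have hDm : ∀ i, MeasurableSet (D i) := fun i => MeasurableSet.disjointed hS i
  have hDS : ∀ i, D i ⊆ S i := disjointed_subset S
  have hdisj : Pairwise (Function.onFun Disjoint D) := disjoint_disjointed S
  have hDcov : ∀ x ∈ Ω, ∃ i < n, x ∈ D i := by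
    intro x hx
    obtain ⟨j, hj, hxj⟩ := hcov x hx
    have hmem : x ∈ partialSups S j := le_partialSups S j hxj
    rw [← biUnion_Iic_disjointed] at hmem
    obtain ⟨i, hi, hxi⟩ := Set.mem_iUnion₂.1 hmem
    exact ⟨i, (Finset.mem_Iic.1 hi).trans_lt hj, hxi⟩
  have hΩD : Ω = ⋃ i ∈ Finset.range n, D i := by
    ext x
    simp only [Set.mem_iUnion, Finset.mem_range, exists_prop]
    exact ⟨hDcov x, fun ⟨i, _, hi⟩ => hSΩ i (hDS i hi)⟩
  have hfin : ∀ i, ν (D i) ≠ ⊤ := fun i => measure_ne_top_of_subset ((hDS i).trans (hSΩ i)) hΩ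
  have hle : ∀ i ∈ Finset.range n, ν.real (D i) ≤ (n : ℝ)⁻¹ * ν.real Ω := fun i _ =>
    (measureReal_mono (hDS i) (measure_ne_top_of_subset (hSΩ i) hΩ)).trans (hvol i)
  have hsum : ∑ i ∈ Finset.range n, ν.real (D i)
      = ∑ i ∈ Finset.range n, (n : ℝ)⁻¹ * ν.real Ω := by
    rw [← measureReal_biUnion_finset (fun i _ j _ hij => hdisj hij) (fun i _ => hDm i)
      (fun i _ => hfin i), ← hΩD, Finset.sum_const, Finset.card_range, nsmul_eq_mul]
    field_simp
  have hDvol := (Finset.sum_eq_sum_iff_of_le hle).1 hsum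
  have hint : ∀ i, IntegrableOn ((D i).indicator fun _ => c i) Ω ν := fun i =>
    ((integrable_indicator_iff (hDm i)).2 (integrableOn_const (hfin i))).integrableOn
  refine ⟨fun x => ∑ i ∈ Finset.range n, (D i).indicator (fun _ => c i) x,
    integrable_finsetSum _ fun i _ => hint i, ?_, ?_⟩
  · rw [integral_finsetSum _ fun i _ => hint i, Finset.mul_sum, Finset.mul_sum]
    refine Finset.sum_congr rfl fun i hi => ?_
    rw [setIntegral_indicator (hDm i), Set.inter_eq_right.2 ((hDS i).trans (hSΩ i)),
      setIntegral_const, hDvol i hi, smul_eq_mul]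
    ring
  · intro x hx
    obtain ⟨i, hi, hxi⟩ := hDcov x hx
    refine ⟨i, hi, hDS i hxi, ?_⟩
    dsimp only
    rw [Finset.sum_eq_single_of_mem i (Finset.mem_range.2 hi), Set.indicator_of_mem hxi]
    intro j _ hji
    exact Set.indicator_of_notMem (fun hxj => Set.disjoint_left.1 (hdisj hji) hxj hxi) _

end Sandwich

section Triangles

open scoped Pointwise

theorem mem_triangle_iff {A B C x : Pt} : x ∈ triangle A B C ↔
    ∃ a b c : ℝ, 0 ≤ a ∧ 0 ≤ b ∧ 0 ≤ c ∧ a + b + c = 1 ∧ x = a • A + b • B + c • C := by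
  constructor
  · intro hx
    rw [triangle, convexHull_insert (Set.insert_nonempty _ _), convexHull_pair,
      mem_convexJoin] at hx
    obtain ⟨y, rfl, z, ⟨s, t, hs, ht, hst, rfl⟩, p, q, hp, hq, hpq, rfl⟩ := hx
    refine ⟨p, q * s, q * t, hp, by positivity, by positivity, ?_, ?_⟩
    · rw [add_assoc, ← mul_add, hst, mul_one, hpq]
    · module
  · rintro ⟨a, b, c, ha, hb, hc, h, rfl⟩
    have key := (convex_convexHull ℝ ({A, B, C} : Set Pt)).sum_mem (t := Finset.univ)
      (w := ![a, b, c]) (z := ![A, B, C])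
      (by intro i _; fin_cases i <;> simpa)
      (by simpa [Fin.sum_univ_three] using h)
      (by intro i _; refine subset_convexHull ℝ _ ?_; fin_cases i <;> simp)
    simpa [Fin.sum_univ_three, triangle] using key

theorem isCompact_triSet (T : Tri2) : IsCompact (triSet T) :=
  ((Set.toFinite _).insert _).isCompact_convexHull ℝ

theorem triSet_nonempty (T : Tri2) : (triSet T).Nonempty :=
  ⟨T.1, subset_convexHull ℝ _ (Set.mem_insert _ _)⟩

theorem measurableSet_triSet (T : Tri2) : MeasurableSet (triSet T) :=
  (isCompact_triSet T).isClosed.measurableSet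

theorem triangle_add_smul (z A B C : Pt) (r : ℝ) :
    triangle (z + r • A) (z + r • B) (z + r • C) = z +ᵥ r • triangle A B C := by
  simp only [triangle, ← convexHull_smul, ← convexHull_vadd, Set.smul_set_insert,
    Set.smul_set_singleton, Set.vadd_set_insert, Set.vadd_set_singleton, vadd_eq_add]

theorem volume_real_triangle_add_smul (z A B C : Pt) (r : ℝ) :
    volume.real (triangle (z + r • A) (z + r • B) (z + r • C))
      = r ^ 2 * volume.real (triangle A B C) := by
  rw [triangle_add_smul, measureReal_def, measure_vadd, Measure.addHaar_smul]
  simp [measureReal_def, ENNReal.toReal_mul, Module.finrank_prod, sq_nonneg]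

theorem volume_real_subdiv (T : Tri2) (d : ℕ) :
    volume.real (triSet (subdiv T d)) = 4⁻¹ * volume.real (triSet T) := by
  obtain ⟨A, B, C⟩ := T
  have key : ∀ (z : Pt) (r : ℝ), r ^ 2 = 4⁻¹ →
      subdiv (A, B, C) d = (z + r • A, z + r • B, z + r • C) →
      volume.real (triSet (subdiv (A, B, C) d)) = 4⁻¹ * volume.real (triSet (A, B, C)) := by
    intro z r hr h
    rw [h, ← hr]
    exact volume_real_triangle_add_smul z A B C r
  by_cases h0 : d = 0
  · refine key ((2⁻¹ : ℝ) • (A + B + C)) (-2⁻¹) (by norm_num) ?_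
    simp only [subdiv, h0, if_true, mid, Prod.mk.injEq]
    refine ⟨?_, ?_, ?_⟩ <;> module
  by_cases h1 : d = 1
  · refine key ((2⁻¹ : ℝ) • A) 2⁻¹ (by norm_num) ?_
    simp only [subdiv, h1, one_ne_zero, if_true, if_false, mid, Prod.mk.injEq]
    refine ⟨?_, ?_, ?_⟩ <;> module
  by_cases h2 : d = 2
  · refine key ((2⁻¹ : ℝ) • B) 2⁻¹ (by norm_num) ?_
    simp only [subdiv, h2, if_true, if_false, mid, Prod.mk.injEq, OfNat.ofNat_ne_zero,
      OfNat.ofNat_ne_one]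
    refine ⟨?_, ?_, ?_⟩ <;> module
  · refine key ((2⁻¹ : ℝ) • C) 2⁻¹ (by norm_num) ?_
    simp only [subdiv, h0, h1, h2, if_false, mid, Prod.mk.injEq]
    refine ⟨?_, ?_, ?_⟩ <;> module

theorem mid_mem_triSet {T : Tri2} {P Q : Pt} (hP : P ∈ triSet T) (hQ : Q ∈ triSet T) :
    mid P Q ∈ triSet T := by
  rw [mid, smul_add]
  exact convex_convexHull ℝ _ hP hQ (by norm_num) (by norm_num) (by norm_num)

theorem triSet_subdiv_subset (T : Tri2) (d : ℕ) : triSet (subdiv T d) ⊆ triSet T := by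
  have hA : T.1 ∈ triSet T := subset_convexHull ℝ _ (by simp)
  have hB : T.2.1 ∈ triSet T := subset_convexHull ℝ _ (by simp)
  have hC : T.2.2 ∈ triSet T := subset_convexHull ℝ _ (by simp)
  have hBC := mid_mem_triSet hB hC
  have hAC := mid_mem_triSet hA hC
  have hAB := mid_mem_triSet hA hB
  refine convexHull_min ?_ (convex_convexHull ℝ _)
  unfold subdiv
  split_ifs <;> simp only [Set.insert_subset_iff, Set.singleton_subset_iff] <;>
    refine ⟨?_, ?_, ?_⟩ <;> assumption

theorem exists_mem_triSet_subdiv {T : Tri2} {x : Pt} (hx : x ∈ triSet T) :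
    ∃ d < 4, x ∈ triSet (subdiv T d) := by
  obtain ⟨A, B, C⟩ := T
  obtain ⟨a, b, c, ha, hb, hc, h, rfl⟩ := mem_triangle_iff.1 hx
  obtain rfl : c = 1 - a - b := by linarith
  by_cases ha' : 1 ≤ 2 * a
  · refine ⟨1, by norm_num, mem_triangle_iff.2
      ⟨2 * a - 1, 2 * b, 2 * (1 - a - b), by linarith, by linarith, by linarith, by ring, ?_⟩⟩
    simp only [subdiv, mid, one_ne_zero, if_true, if_false]
    module
  by_cases hb' : 1 ≤ 2 * b
  · refine ⟨2, by norm_num, mem_triangle_iff.2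
      ⟨2 * a, 2 * b - 1, 2 * (1 - a - b), by linarith, by linarith, by linarith, by ring, ?_⟩⟩
    simp only [subdiv, mid, OfNat.ofNat_ne_zero, OfNat.ofNat_ne_one, if_true, if_false]
    module
  by_cases hc' : 1 ≤ 2 * (1 - a - b)
  · refine ⟨3, by norm_num, mem_triangle_iff.2
      ⟨2 * a, 2 * b, 2 * (1 - a - b) - 1, by linarith, by linarith, by linarith, by ring, ?_⟩⟩
    simp only [subdiv, mid, OfNat.ofNat_ne_zero, OfNat.ofNat_ne_one, if_false,
      show (3 : ℕ) ≠ 2 by norm_num]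
    module
  · refine ⟨0, by norm_num, mem_triangle_iff.2
      ⟨1 - 2 * a, 1 - 2 * b, 1 - 2 * (1 - a - b), by linarith, by linarith, by linarith,
        by ring, ?_⟩⟩
    simp only [subdiv, mid, if_true]
    module

theorem triSet_subdivAt_subset (T : Tri2) (k i : ℕ) : triSet (subdivAt T k i) ⊆ triSet T := by
  induction k generalizing i with
  | zero => exact subset_rfl
  | succ k ih => exact (triSet_subdiv_subset _ _).trans (ih _)

theorem volume_real_subdivAt (T : Tri2) (k i : ℕ) :
    volume.real (triSet (subdivAt T k i)) = (4 ^ k : ℝ)⁻¹ * volume.real (triSet T) := by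
  induction k generalizing i with
  | zero => simp [subdivAt]
  | succ k ih => rw [subdivAt, volume_real_subdiv, ih, pow_succ, mul_inv]; ring

theorem exists_mem_triSet_subdivAt {T : Tri2} {x : Pt} (hx : x ∈ triSet T) (k : ℕ) :
    ∃ i < 4 ^ k, x ∈ triSet (subdivAt T k i) := by
  induction k with
  | zero => exact ⟨0, by simp, hx⟩
  | succ k ih =>
    obtain ⟨i, hi, hxi⟩ := ih
    obtain ⟨d, hd, hxd⟩ := exists_mem_triSet_subdiv hxi
    refine ⟨4 * i + d, by rw [pow_succ]; omega, ?_⟩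
    rwa [subdivAt, show (4 * i + d) / 4 = i by omega, show (4 * i + d) % 4 = d by omega]

end Triangles

/-- A bounded Riemann integrable function on a triangle has integrable step functions above it
whose integrals converge to the Riemann integral. -/
theorem RiemannMean.exists_upper_steps {T : Tri2} {f : Pt → ℝ} {μ : ℝ}
    (hμ : RiemannMean T f μ) (hf : BddAbove (f '' triSet T)) :
    ∃ u : ℕ → Pt → ℝ, (∀ k, IntegrableOn (u k) (triSet T)) ∧
      (∀ k, ∀ x ∈ triSet T, f x ≤ u k x) ∧
      Tendsto (fun k => ∫ x in triSet T, u k x) atTop (nhds (μ * vol (triSet T))) := by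
  have htag : ∀ k i : ℕ, ∃ x ∈ triSet (subdivAt T k i),
      ∀ y ∈ triSet (subdivAt T k i), f y ≤ f x + 1 / ((k : ℝ) + 1) := by
    intro k i
    have hbdd := hf.mono (Set.image_mono (triSet_subdivAt_subset T k i))
    obtain ⟨_, ⟨x, hx, rfl⟩, hlt⟩ := exists_lt_of_lt_csSup ((triSet_nonempty _).image f)
      (sub_lt_self (sSup (f '' triSet (subdivAt T k i))) (Nat.one_div_pos_of_nat (n := k)))
    refine ⟨x, hx, fun y hy => ?_⟩
    have := le_csSup hbdd (Set.mem_image_of_mem f hy)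
    linarith
  choose x hx hxf using htag
  have hstep := fun k => exists_step_function (ν := volume) (isCompact_triSet T).measure_ne_top
    (n := 4 ^ k) (by positivity) (fun i => measurableSet_triSet (subdivAt T k i))
    (triSet_subdivAt_subset T k) (fun _ hy => exists_mem_triSet_subdivAt hy k)
    (fun i => by rw [volume_real_subdivAt]; push_cast; rfl)
    (fun i => f (x k i) + 1 / ((k : ℝ) + 1))
  choose u hui huint hu using hstep
  refine ⟨u, hui, fun k y hy => ?_, ?_⟩
  · obtain ⟨i, _, hyi, h⟩ := hu k y hy
    exact (hxf k i y hyi).trans_eq h.symm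
  · have hlim := ((hμ x fun k i _ => hx k i).add tendsto_one_div_add_atTop_nhds_zero_nat).const_mul
      (vol (triSet T))
    rw [add_zero, mul_comm] at hlim
    refine hlim.congr fun k => ?_
    rw [huint, Finset.sum_add_distrib, Finset.sum_const, Finset.card_range, nsmul_eq_mul,
      mul_add (_ : ℝ)⁻¹, inv_mul_cancel_left₀ (by positivity)]
    push_cast
    rfl

theorem RiemannMean.neg {T : Tri2} {f : Pt → ℝ} {μ : ℝ} (hμ : RiemannMean T f μ) :
    RiemannMean T (fun x => -f x) (-μ) := by
  intro x hx
  simpa only [Finset.sum_neg_distrib, mul_neg] using (hμ x hx).neg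

/-- a bounded, Riemann integrable (triangular-subdivision sense)
function on a nondegenerate closed triangle is Lebesgue integrable on the triangle,
and its Lebesgue integral equals `μ · vol(T)`. -/
theorem riemann_eq_lebesgue (T : Tri2) (h : Nondeg T.1 T.2.1 T.2.2)
    (f : Pt → ℝ) (Mb : ℝ) (hb : ∀ x ∈ triSet T, |f x| ≤ Mb)
    (μ : ℝ) (hμ : RiemannMean T f μ) :
    IntegrableOn f (triSet T) volume ∧ ∫ x in triSet T, f x = μ * vol (triSet T) := by
  obtain ⟨u, hui, hfu, hu⟩ := hμ.exists_upper_steps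
    ⟨Mb, Set.forall_mem_image.2 fun x hx => (abs_le.1 (hb x hx)).2⟩
  obtain ⟨l, hli, hfl, hl⟩ := hμ.neg.exists_upper_steps
    ⟨Mb, Set.forall_mem_image.2 fun x hx => neg_le.1 (abs_le.1 (hb x hx)).1⟩
  refine integrable_and_integral_eq_of_squeeze (l := fun k x => -l k x) (fun k => (hli k).neg) hui
    (fun k => ?_) (fun k => ?_) ?_ hu
  · filter_upwards [ae_restrict_mem (measurableSet_triSet T)] with x hx
    exact neg_le.1 (hfl k x hx)
  · filter_upwards [ae_restrict_mem (measurableSet_triSet T)] with x hx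
    exact hfu k x hx
  · simpa only [integral_neg, neg_mul, neg_neg] using hl.neg
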